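/- For the normal–truncated-normal pseudo conditional density with fixed x, β, μ and σ_v, σ_u > 0, the score with respect to μ is unbounded in y: sup_{y∈ℝ} |∂_μ log f_θ(y|x)| = ∞. Consequently the quasi-maximum-likelihood (α = 0) objective satisfies sup_{y∈ℝ} ‖∂_θ H_0(x,y;θ)‖ = ∞, where H_0(x,y;θ) = −log f_θ(y|x); in particular the influence function of the QML estimator is unbounded in the contamination point y_0. -/

import Mathlib

open MeasureTheory ProbabilityTheory Real Set Filter
open scoped ENNReal NNReal

/-- The standard normal density φ(t) = (2π)^{-1/2} e^{-t²/2}. -/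
noncomputable def stdGaussPdf (t : ℝ) : ℝ := (Real.sqrt (2 * Real.pi))⁻¹ * Real.exp (-(t ^ 2) / 2)

/-- The standard normal cumulative distribution function Φ. -/
noncomputable def stdGaussCdf (t : ℝ) : ℝ := ∫ s in Set.Iic t, stdGaussPdf s

/-- The normal–truncated-normal pseudo conditional density
f_θ(y|x) = (1/σ)[1−Φ(−μ/σ_u)]⁻¹ φ((y−g(x,β)+μ)/σ) Φ(μ/(σλ) − λ(y−g(x,β))/σ),
with σ² = σ_v² + σ_u², λ = σ_u/σ_v, and θ = (β, μ, σ_v, σ_u). -/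
noncomputable def fNT {p q : ℕ} (g : (Fin p → ℝ) → (Fin q → ℝ) → ℝ)
    (θ : (Fin q → ℝ) × ℝ × ℝ × ℝ) (x : Fin p → ℝ) (y : ℝ) : ℝ :=
  let β := θ.1; let μ := θ.2.1; let σv := θ.2.2.1; let σu := θ.2.2.2
  let σ := Real.sqrt (σv ^ 2 + σu ^ 2)
  let lam := σu / σv
  σ⁻¹ * (1 - stdGaussCdf (-(μ / σu)))⁻¹ * stdGaussPdf ((y - g x β + μ) / σ) *
    stdGaussCdf (μ / (σ * lam) - lam * (y - g x β) / σ)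

/-- The normal–exponential pseudo conditional density
f_θ(y|x) = (1/σ_u) Φ(−(y−g(x,β))/σ_v − σ_v/σ_u) exp((y−g(x,β))/σ_u + σ_v²/(2σ_u²)),
with θ = (β, σ_v, σ_u). -/
noncomputable def fNE {p q : ℕ} (g : (Fin p → ℝ) → (Fin q → ℝ) → ℝ)
    (θ : (Fin q → ℝ) × ℝ × ℝ) (x : Fin p → ℝ) (y : ℝ) : ℝ :=
  let β := θ.1; let σv := θ.2.1; let σu := θ.2.2
  σu⁻¹ * stdGaussCdf (-((y - g x β) / σv) - σv / σu) *
    Real.exp ((y - g x β) / σu + σv ^ 2 / (2 * σu ^ 2))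

/-- The objective function H_α(x,y;θ) = ∫ f_θ^{1+α}(y'|x) dy' − (1+1/α) f_θ^α(y|x)
of the minimum density power divergence estimator. -/
noncomputable def dpdH {P XS : Type*} (a : ℝ) (f : P → XS → ℝ → ℝ)
    (θ : P) (x : XS) (y : ℝ) : ℝ :=
  (∫ y' : ℝ, f θ x y' ^ (1 + a)) - (1 + 1 / a) * f θ x y ^ a

/-- The compact parameter box Θ = [b̲,b̄]^q × [u̲,ū] × [σ̲,σ̄]² of the
normal–truncated-normal specification. -/
def boxNT (q : ℕ) (bl bu ul uu sl su : ℝ) : Set ((Fin q → ℝ) × ℝ × ℝ × ℝ) :=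
  (Set.Icc (fun _ => bl) (fun _ => bu)) ×ˢ ((Set.Icc ul uu) ×ˢ ((Set.Icc sl su) ×ˢ (Set.Icc sl su)))

/-- The compact parameter box Θ = [b̲,b̄]^q × [σ̲,σ̄]² of the normal–exponential
specification. -/
def boxNE (q : ℕ) (bl bu sl su : ℝ) : Set ((Fin q → ℝ) × ℝ × ℝ) :=
  (Set.Icc (fun _ => bl) (fun _ => bu)) ×ˢ ((Set.Icc sl su) ×ˢ (Set.Icc sl su))

lemma stdGaussPdf_eq_gaussianPDFReal : stdGaussPdf = gaussianPDFReal 0 1 := by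
  ext t
  simp [stdGaussPdf, gaussianPDFReal]

lemma stdGaussPdf_pos (t : ℝ) : 0 < stdGaussPdf t := by
  unfold stdGaussPdf
  positivity

lemma continuous_stdGaussPdf : Continuous stdGaussPdf := by
  unfold stdGaussPdf
  fun_prop

lemma integrable_stdGaussPdf : Integrable stdGaussPdf := by
  rw [stdGaussPdf_eq_gaussianPDFReal]
  exact integrable_gaussianPDFReal 0 1

lemma setIntegral_stdGaussPdf_pos {s : Set ℝ} (hs : volume s ≠ 0) :
    0 < ∫ t in s, stdGaussPdf t := by
  rw [integral_pos_iff_support_of_nonneg (fun t => (stdGaussPdf_pos t).le)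
    integrable_stdGaussPdf.integrableOn]
  have h : Function.support stdGaussPdf = Set.univ :=
    Set.eq_univ_of_forall fun t => (stdGaussPdf_pos t).ne'
  rw [h, Measure.restrict_apply_univ]
  exact pos_iff_ne_zero.mpr hs

lemma stdGaussCdf_pos (t : ℝ) : 0 < stdGaussCdf t :=
  setIntegral_stdGaussPdf_pos (by simp)

lemma stdGaussCdf_lt_one (t : ℝ) : stdGaussCdf t < 1 := by
  have h₁ : 0 < ∫ s in Set.Ioi t, stdGaussPdf s := setIntegral_stdGaussPdf_pos (by simp)
  have h₂ : stdGaussCdf t + ∫ s in Set.Ioi t, stdGaussPdf s = ∫ s, stdGaussPdf s :=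
    intervalIntegral.integral_Iic_add_Ioi integrable_stdGaussPdf.integrableOn
      integrable_stdGaussPdf.integrableOn
  rw [stdGaussPdf_eq_gaussianPDFReal, integral_gaussianPDFReal_eq_one 0 one_ne_zero,
    ← stdGaussPdf_eq_gaussianPDFReal] at h₂
  linarith

lemma hasDerivAt_stdGaussCdf (t : ℝ) : HasDerivAt stdGaussCdf (stdGaussPdf t) t := by
  have h : stdGaussCdf = fun u => stdGaussCdf 0 + ∫ s in (0 : ℝ)..u, stdGaussPdf s := by
    ext u
    have := intervalIntegral.integral_Iic_sub_Iic (a := 0) (b := u)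
      integrable_stdGaussPdf.integrableOn integrable_stdGaussPdf.integrableOn
    simp only [stdGaussCdf]
    linarith
  rw [h]
  exact (intervalIntegral.integral_hasDerivAt_right
    (continuous_stdGaussPdf.intervalIntegrable _ _)
    (continuous_stdGaussPdf.stronglyMeasurableAtFilter _ _)
    continuous_stdGaussPdf.continuousAt).const_add _

lemma differentiable_stdGaussCdf : Differentiable ℝ stdGaussCdf :=
  fun t => (hasDerivAt_stdGaussCdf t).differentiableAt

lemma differentiable_stdGaussPdf : Differentiable ℝ stdGaussPdf := by
  unfold stdGaussPdf
  fun_prop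

lemma log_stdGaussPdf (t : ℝ) :
    Real.log (stdGaussPdf t) = Real.log (Real.sqrt (2 * Real.pi))⁻¹ - t ^ 2 / 2 := by
  rw [stdGaussPdf, Real.log_mul (by positivity) (Real.exp_pos _).ne', Real.log_exp]
  ring

section Score

variable {p q : ℕ} (g : (Fin p → ℝ) → (Fin q → ℝ) → ℝ) (x : Fin p → ℝ) (β : Fin q → ℝ)
  (μ : ℝ) {σv σu : ℝ}

lemma fNT_pos (hσv : 0 < σv) (y : ℝ) : 0 < fNT g (β, μ, σv, σu) x y := by
  have hA := sub_pos.mpr (stdGaussCdf_lt_one (-(μ / σu)))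
  have hφ := stdGaussPdf_pos ((y - g x β + μ) / Real.sqrt (σv ^ 2 + σu ^ 2))
  have hΦ := stdGaussCdf_pos (μ / (Real.sqrt (σv ^ 2 + σu ^ 2) * (σu / σv)) -
    σu / σv * (y - g x β) / Real.sqrt (σv ^ 2 + σu ^ 2))
  simp only [fNT]
  positivity

/-- The score of the normal–truncated-normal density with respect to `μ`. -/
lemma hasDerivAt_log_fNT (hσv : 0 < σv) (y : ℝ) :
    HasDerivAt (fun μ' => Real.log (fNT g (β, μ', σv, σu) x y))
      (-(stdGaussPdf (-(μ / σu)) / σu / (1 - stdGaussCdf (-(μ / σu)))) +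
        (-((y - g x β + μ) / Real.sqrt (σv ^ 2 + σu ^ 2)) / Real.sqrt (σv ^ 2 + σu ^ 2) +
        stdGaussPdf (μ / (Real.sqrt (σv ^ 2 + σu ^ 2) * (σu / σv)) -
            σu / σv * (y - g x β) / Real.sqrt (σv ^ 2 + σu ^ 2)) /
          (Real.sqrt (σv ^ 2 + σu ^ 2) * (σu / σv)) /
          stdGaussCdf (μ / (Real.sqrt (σv ^ 2 + σu ^ 2) * (σu / σv)) -
            σu / σv * (y - g x β) / Real.sqrt (σv ^ 2 + σu ^ 2)))) μ := by
  have hσ : 0 < Real.sqrt (σv ^ 2 + σu ^ 2) := by positivity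
  simp only [fNT]
  generalize Real.sqrt (σv ^ 2 + σu ^ 2) = σ at hσ ⊢
  generalize σu / σv = lam
  generalize y - g x β = z
  have hA (m : ℝ) : 1 - stdGaussCdf (-(m / σu)) ≠ 0 :=
    (sub_pos.mpr (stdGaussCdf_lt_one _)).ne'
  have hlog : (fun m => Real.log (σ⁻¹ * (1 - stdGaussCdf (-(m / σu)))⁻¹ *
        stdGaussPdf ((z + m) / σ) * stdGaussCdf (m / (σ * lam) - lam * z / σ))) =
      fun m => (Real.log σ⁻¹ - Real.log (1 - stdGaussCdf (-(m / σu)))) +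
        ((Real.log (Real.sqrt (2 * Real.pi))⁻¹ - ((z + m) / σ) ^ 2 / 2) +
        Real.log (stdGaussCdf (m / (σ * lam) - lam * z / σ))) := by
    ext m
    have hφ := (stdGaussPdf_pos ((z + m) / σ)).ne'
    have hσ' := (inv_pos.mpr hσ).ne'
    have hA' := inv_ne_zero (hA m)
    rw [Real.log_mul (by simp_all) (stdGaussCdf_pos _).ne',
      Real.log_mul (by simp_all) hφ, Real.log_mul hσ' hA', Real.log_inv (1 - _),
      log_stdGaussPdf]
    ring
  rw [hlog]
  have h₁ : HasDerivAt (fun m : ℝ => -(m / σu)) (-(1 / σu)) μ :=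
    ((hasDerivAt_id μ).div_const σu).neg
  have h₂ : HasDerivAt (fun m : ℝ => (z + m) / σ) (1 / σ) μ :=
    ((hasDerivAt_id μ).const_add z).div_const σ
  have h₃ : HasDerivAt (fun m : ℝ => m / (σ * lam) - lam * z / σ) (1 / (σ * lam)) μ :=
    ((hasDerivAt_id μ).div_const _).sub_const _
  have d₁ := ((((hasDerivAt_stdGaussCdf _).comp μ h₁).const_sub 1).log (hA μ)).const_sub
    (Real.log σ⁻¹)
  have d₂ := ((h₂.pow 2).div_const 2).const_sub (Real.log (Real.sqrt (2 * Real.pi))⁻¹)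
  have d₃ := ((hasDerivAt_stdGaussCdf _).comp μ h₃).log (stdGaussCdf_pos _).ne'
  refine (d₁.add (d₂.add d₃)).congr_deriv ?_
  simp only [Function.comp_apply]
  push_cast
  ring

lemma exists_lt_deriv_log_fNT (hσv : 0 < σv) (hσu : 0 < σu) (C : ℝ) :
    ∃ y : ℝ, C < deriv (fun μ' => Real.log (fNT g (β, μ', σv, σu) x y)) μ := by
  have hσ : 0 < Real.sqrt (σv ^ 2 + σu ^ 2) := by positivity
  set σ := Real.sqrt (σv ^ 2 + σu ^ 2) with hσ_def
  set a := stdGaussPdf (-(μ / σu)) / σu / (1 - stdGaussCdf (-(μ / σu))) with ha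
  refine ⟨g x β - μ - (C + a + 1) * σ * σ, ?_⟩
  rw [(hasDerivAt_log_fNT g x β μ hσv _).deriv, ← hσ_def, ← ha]
  have hz : -((g x β - μ - (C + a + 1) * σ * σ - g x β + μ) / σ) / σ = C + a + 1 := by
    field_simp
    ring
  rw [hz]
  have hr (t : ℝ) : 0 < stdGaussPdf t / (σ * (σu / σv)) / stdGaussCdf t := by
    have := stdGaussPdf_pos t
    have := stdGaussCdf_pos t
    positivity
  linarith [hr (μ / (σ * (σu / σv)) -
    σu / σv * (g x β - μ - (C + a + 1) * σ * σ - g x β) / σ)]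

lemma differentiableAt_fNT (hσv : 0 < σv) (hσu : 0 < σu) (hg : DifferentiableAt ℝ (g x) β)
    (y : ℝ) : DifferentiableAt ℝ (fun θ => fNT g θ x y) (β, μ, σv, σu) := by
  have hσ : Real.sqrt (σv ^ 2 + σu ^ 2) ≠ 0 := by positivity
  have hA : 1 - stdGaussCdf (-(μ / σu)) ≠ 0 := (sub_pos.mpr (stdGaussCdf_lt_one _)).ne'
  have hβ : DifferentiableAt ℝ (fun θ : (Fin q → ℝ) × ℝ × ℝ × ℝ => g x θ.1) (β, μ, σv, σu) :=
    DifferentiableAt.comp (g := g x) (β, μ, σv, σu) hg differentiableAt_fst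
  have dm : DifferentiableAt ℝ
      (fun θ : (Fin q → ℝ) × ℝ × ℝ × ℝ => θ.2.1) (β, μ, σv, σu) := by fun_prop
  have dv : DifferentiableAt ℝ
      (fun θ : (Fin q → ℝ) × ℝ × ℝ × ℝ => θ.2.2.1) (β, μ, σv, σu) := by fun_prop
  have du : DifferentiableAt ℝ
      (fun θ : (Fin q → ℝ) × ℝ × ℝ × ℝ => θ.2.2.2) (β, μ, σv, σu) := by fun_prop
  have dσ : DifferentiableAt ℝ
      (fun θ : (Fin q → ℝ) × ℝ × ℝ × ℝ => Real.sqrt (θ.2.2.1 ^ 2 + θ.2.2.2 ^ 2))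
      (β, μ, σv, σu) :=
    DifferentiableAt.sqrt (by fun_prop) (by positivity)
  have dl : DifferentiableAt ℝ
      (fun θ : (Fin q → ℝ) × ℝ × ℝ × ℝ => θ.2.2.2 / θ.2.2.1) (β, μ, σv, σu) :=
    du.fun_mul (dv.fun_inv hσv.ne')
  have dA : DifferentiableAt ℝ
      (fun θ : (Fin q → ℝ) × ℝ × ℝ × ℝ => -(θ.2.1 / θ.2.2.2)) (β, μ, σv, σu) :=
    (dm.fun_mul (du.fun_inv hσu.ne')).fun_neg
  have dz := hβ.const_sub y
  simp only [fNT]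
  refine (((dσ.fun_inv hσ).fun_mul
    (((differentiable_stdGaussCdf _).fun_comp' _ dA |>.const_sub 1).fun_inv hA)).fun_mul
    ((differentiable_stdGaussPdf _).fun_comp' _ ((dz.fun_add dm).fun_mul (dσ.fun_inv hσ)))).fun_mul
    ((differentiable_stdGaussCdf _).fun_comp' _
      ((dm.fun_mul ((dσ.fun_mul dl).fun_inv (by positivity))).fun_sub
        ((dl.fun_mul dz).fun_mul (dσ.fun_inv hσ))))

lemma abs_deriv_log_fNT_le_norm_fderiv (hσv : 0 < σv) (hσu : 0 < σu)
    (hg : DifferentiableAt ℝ (g x) β) (y : ℝ) :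
    |deriv (fun μ' => Real.log (fNT g (β, μ', σv, σu) x y)) μ| ≤
      ‖fderiv ℝ (fun θ : (Fin q → ℝ) × ℝ × ℝ × ℝ => -Real.log (fNT g θ x y))
        (β, μ, σv, σu)‖ := by
  have hd := ((differentiableAt_fNT g x β μ hσv hσu hg y).log
    (fNT_pos g x β μ hσv y).ne').fun_neg.hasFDerivAt
  have hc : HasDerivAt (fun m : ℝ => (β, m, σv, σu)) ((0 : Fin q → ℝ), (1 : ℝ), (0 : ℝ), (0 : ℝ))
      μ :=
    (hasDerivAt_const μ β).prodMk ((hasDerivAt_id μ).prodMk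
      ((hasDerivAt_const μ σv).prodMk (hasDerivAt_const μ σu)))
  have hcomp := (hd.comp_hasDerivAt μ hc).fun_neg
  simp only [Function.comp_apply, neg_neg] at hcomp
  rw [hcomp.deriv, abs_neg, ← Real.norm_eq_abs]
  refine (ContinuousLinearMap.le_opNorm _ _).trans_eq ?_
  simp [Prod.norm_def]

end Score

/-- for the normal–truncated-normal pseudo conditional density with fixed
x, β, μ and σ_v, σ_u > 0, the score ∂_μ log f_θ(y|x) is unbounded in y; consequently,
for H_0(x,y;θ) = −log f_θ(y|x) (the quasi-ML objective, α = 0),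
sup_{y∈ℝ} ‖∂_θ H_0(x,y;θ)‖ = ∞, so the influence function of the QML estimator is
unbounded in the contamination point. -/
theorem qml_score_unbounded {p q : ℕ} (g : (Fin p → ℝ) → (Fin q → ℝ) → ℝ)
    (x : Fin p → ℝ) (β : Fin q → ℝ) (μ σv σu : ℝ)
    (hσv : 0 < σv) (hσu : 0 < σu)
    (hg : DifferentiableAt ℝ (g x) β) :
    (∀ C : ℝ, ∃ y : ℝ,
        C < |deriv (fun μ' => Real.log (fNT g (β, μ', σv, σu) x y)) μ|)
    ∧ ∀ C : ℝ, ∃ y : ℝ,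
        C < ‖fderiv ℝ
              (fun θ : (Fin q → ℝ) × ℝ × ℝ × ℝ => -Real.log (fNT g θ x y))
              (β, μ, σv, σu)‖ := by
  have h (C : ℝ) : ∃ y : ℝ,
      C < |deriv (fun μ' => Real.log (fNT g (β, μ', σv, σu) x y)) μ| :=
    (exists_lt_deriv_log_fNT g x β μ hσv hσu C).imp fun _ hy => hy.trans_le (le_abs_self _)
  exact ⟨h, fun C => (h C).imp fun y hy =>
    hy.trans_le (abs_deriv_log_fNT_le_norm_fderiv g x β μ hσv hσu hg y)⟩
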